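/- Let ε > 0 and z = e^ε + e^{-ε}, and let p be a computation-register state on Fin 2^n with p' = PPA(p). If for some index i one has p_i / p_{i+1} ≥ e^{2ε} (equivalently, p_i e^{-ε}/z ≥ p_{i+1} e^ε/z, so there is no crossing between positions i and i+1), then p'_i ≤ p_i and p'_{i+1} ≥ p_{i+1}; in particular p'_i / p'_{i+1} ≤ p_i / p_{i+1}. -/

import Mathlib

open Real Filter

/-- The multiset of `2^(n+1)` joint probabilities `p i * e^±ε / z`,
sorted in decreasing order (as a list, largest first):
entry `j` of this list is `λ_{j+1}` in the 1-indexed notation of the paper. -/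
noncomputable def ppaSorted (n : ℕ) (ε : ℝ) (p : Fin (2^n) → ℝ) : List ℝ :=
  ((((Finset.univ : Finset (Fin (2^n))).val.map
      fun j => p j * Real.exp ε / (Real.exp ε + Real.exp (-ε))) +
    ((Finset.univ : Finset (Fin (2^n))).val.map
      fun j => p j * Real.exp (-ε) / (Real.exp ε + Real.exp (-ε)))).sort (· ≤ ·)).reverse

/-- One iteration of the Partner Pairing Algorithm with a reset qubit of
polarization ε: `p'_i = λ_{2i+1} + λ_{2i+2}` (1-indexed) of the sorted joint probabilities. -/
noncomputable def PPA (n : ℕ) (ε : ℝ) (p : Fin (2^n) → ℝ) : Fin (2^n) → ℝ :=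
  fun i => (ppaSorted n ε p).getD (2 * (i : ℕ)) 0 + (ppaSorted n ε p).getD (2 * (i : ℕ) + 1) 0

/-- A computation-register state: strictly positive entries, sorted in
decreasing order, summing to 1. -/
def IsCompState (n : ℕ) (p : Fin (2^n) → ℝ) : Prop :=
  (∀ i, 0 < p i) ∧ Antitone p ∧ ∑ i, p i = 1

/-- In a decreasing list with at most `k` entries above `c ≥ 0`, the entry at position `k` is at
most `c`. -/
theorem List.getD_le_of_countP_le {L : List ℝ} (hL : L.Pairwise (· ≥ ·)) {k : ℕ} {c : ℝ}
    (hc : 0 ≤ c) (h : L.countP (fun x => c < x) ≤ k) : L.getD k 0 ≤ c := by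
  by_cases hk : k < L.length
  · rw [List.getD_eq_getElem _ _ hk]
    by_contra! hlt
    have hall : (L.take (k + 1)).countP (fun x => c < x) = (L.take (k + 1)).length := by
      rw [List.countP_eq_length]
      intro x hx
      obtain ⟨j, hj, rfl⟩ := List.mem_take_iff_getElem.1 hx
      have hjk : j ≤ k := by omega
      have : L[k] ≤ L[j] := by
        rcases hjk.eq_or_lt with rfl | hjk
        · exact le_rfl
        · exact List.pairwise_iff_getElem.1 hL j k _ hk hjk
      simpa using hlt.trans_le this
    have hsub := (List.take_sublist (k + 1) L).countP_le (p := fun x => c < x)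
    rw [hall, List.length_take] at hsub
    omega
  · rwa [List.getD_eq_default _ _ (not_lt.1 hk)]

/-- In a decreasing list with more than `k` entries at least `c`, the entry at position `k` is at
least `c`. -/
theorem List.le_getD_of_lt_countP {L : List ℝ} (hL : L.Pairwise (· ≥ ·)) {k : ℕ} {c : ℝ}
    (h : k < L.countP (fun x => c ≤ x)) : c ≤ L.getD k 0 := by
  have hk : k < L.length := h.trans_le List.countP_le_length
  rw [List.getD_eq_getElem _ _ hk]
  by_contra! hlt
  have hnone : (L.drop k).countP (fun x => c ≤ x) = 0 := by
    rw [List.countP_eq_zero]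
    intro x hx
    obtain ⟨j, hj, rfl⟩ := List.mem_drop_iff_getElem.1 hx
    have : L[k + j] ≤ L[k] := by
      rcases Nat.eq_zero_or_pos j with rfl | hj0
      · exact le_rfl
      · exact List.pairwise_iff_getElem.1 hL k (k + j) hk _ (by omega)
    simpa using this.trans_lt hlt
  have hsplit := List.countP_append (p := fun x => c ≤ x) (l₁ := L.take k) (l₂ := L.drop k)
  rw [List.take_append_drop, hnone] at hsplit
  have := List.countP_le_length (p := fun x => c ≤ x) (l := L.take k)
  rw [List.length_take] at this
  omega

theorem pairwise_ppaSorted (n : ℕ) (ε : ℝ) (p : Fin (2 ^ n) → ℝ) :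
    (ppaSorted n ε p).Pairwise (· ≥ ·) := by
  rw [ppaSorted, List.pairwise_reverse]
  exact Multiset.pairwise_sort _ _

open Classical in
theorem countP_ppaSorted (n : ℕ) (ε : ℝ) (p : Fin (2 ^ n) → ℝ) (P : ℝ → Prop) :
    (ppaSorted n ε p).countP (fun x => P x) =
      (Finset.univ.filter fun j =>
        P (p j * Real.exp ε / (Real.exp ε + Real.exp (-ε)))).card +
      (Finset.univ.filter fun j =>
        P (p j * Real.exp (-ε) / (Real.exp ε + Real.exp (-ε)))).card := by
  rw [← Multiset.coe_countP, ppaSorted, Multiset.coe_reverse, Multiset.sort_eq,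
    Multiset.countP_add, Multiset.countP_map, Multiset.countP_map]
  rfl

theorem Fin.card_filter_le_of_imp_lt {N m : ℕ} (P : Fin N → Prop) [DecidablePred P]
    (h : ∀ j, P j → (j : ℕ) < m) : (Finset.univ.filter P).card ≤ m := by
  rw [← Finset.card_map Fin.valEmbedding, ← Finset.card_range m]
  refine Finset.card_le_card fun x hx => ?_
  simp only [Finset.mem_map, Finset.mem_filter, Finset.mem_univ, true_and] at hx
  obtain ⟨j, hj, rfl⟩ := hx
  exact Finset.mem_range.2 (h j hj)

theorem Fin.le_card_filter_of_lt_imp {N m : ℕ} (hm : m ≤ N) (P : Fin N → Prop) [DecidablePred P]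
    (h : ∀ j : Fin N, (j : ℕ) < m → P j) : m ≤ (Finset.univ.filter P).card := by
  rw [← Finset.card_map Fin.valEmbedding]
  conv_lhs => rw [← Finset.card_range m]
  refine Finset.card_le_card fun x hx => ?_
  have hx := Finset.mem_range.1 hx
  simp only [Finset.mem_map, Finset.mem_filter, Finset.mem_univ, true_and]
  exact ⟨⟨x, by omega⟩, h _ hx, rfl⟩

theorem ppaSorted_getD_le {n : ℕ} {ε : ℝ} {p : Fin (2 ^ n) → ℝ} {c : ℝ} (hc : 0 ≤ c)
    {m₁ m₂ k : ℕ} (hk : m₁ + m₂ ≤ k)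
    (h₁ : ∀ j, c < p j * Real.exp ε / (Real.exp ε + Real.exp (-ε)) → (j : ℕ) < m₁)
    (h₂ : ∀ j, c < p j * Real.exp (-ε) / (Real.exp ε + Real.exp (-ε)) → (j : ℕ) < m₂) :
    (ppaSorted n ε p).getD k 0 ≤ c := by
  classical
  refine List.getD_le_of_countP_le (pairwise_ppaSorted n ε p) hc ?_
  have h := countP_ppaSorted n ε p (fun x => c < x)
  refine le_trans (le_of_eq ?_) ((h.trans_le (add_le_add (Fin.card_filter_le_of_imp_lt _ h₁)
    (Fin.card_filter_le_of_imp_lt _ h₂))).trans hk)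
  congr!

theorem le_ppaSorted_getD {n : ℕ} {ε : ℝ} {p : Fin (2 ^ n) → ℝ} {c : ℝ}
    {m₁ m₂ k : ℕ} (hk : k < m₁ + m₂) (hm₁ : m₁ ≤ 2 ^ n) (hm₂ : m₂ ≤ 2 ^ n)
    (h₁ : ∀ j : Fin (2 ^ n), (j : ℕ) < m₁ → c ≤ p j * Real.exp ε / (Real.exp ε + Real.exp (-ε)))
    (h₂ : ∀ j : Fin (2 ^ n),
      (j : ℕ) < m₂ → c ≤ p j * Real.exp (-ε) / (Real.exp ε + Real.exp (-ε))) :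
    c ≤ (ppaSorted n ε p).getD k 0 := by
  classical
  refine List.le_getD_of_lt_countP (pairwise_ppaSorted n ε p) ?_
  have h := countP_ppaSorted n ε p (fun x => c ≤ x)
  refine lt_of_lt_of_eq (hk.trans_le ((add_le_add (Fin.le_card_filter_of_lt_imp hm₁ _ h₁)
    (Fin.le_card_filter_of_lt_imp hm₂ _ h₂)).trans h.ge)) ?_
  congr!

/-- if `p_i / p_{i+1} ≥ e^{2ε}` (no crossing between positions `i`
and `i+1`), then `p'_i ≤ p_i`, `p'_{i+1} ≥ p_{i+1}`, and in particular
`p'_i / p'_{i+1} ≤ p_i / p_{i+1}`. -/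
theorem ppa_crossing_ratio_large (n : ℕ) (hn : 1 ≤ n) (ε : ℝ) (hε : 0 < ε)
    (p : Fin (2^n) → ℝ) (hp : IsCompState n p)
    (i : ℕ) (hi : i + 1 < 2^n)
    (hratio : p ⟨i, by omega⟩ / p ⟨i + 1, hi⟩ ≥ Real.exp (2 * ε)) :
    PPA n ε p ⟨i, by omega⟩ ≤ p ⟨i, by omega⟩ ∧
    PPA n ε p ⟨i + 1, hi⟩ ≥ p ⟨i + 1, hi⟩ ∧
    PPA n ε p ⟨i, by omega⟩ / PPA n ε p ⟨i + 1, hi⟩ ≤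
      p ⟨i, by omega⟩ / p ⟨i + 1, hi⟩ := by
  obtain ⟨hpos, hanti, -⟩ := hp
  set z := Real.exp ε + Real.exp (-ε) with hz
  have hz0 : 0 < z := by positivity
  have hpi := hpos ⟨i, by omega⟩
  have hpi' := hpos ⟨i + 1, hi⟩
  have hexp : Real.exp (-ε) ≤ Real.exp ε := Real.exp_le_exp.2 (by linarith)
  have hmono : ∀ {x y : ℝ}, x ≤ y → x / z ≤ y / z := fun h => by gcongr
  have ha : ∀ {j k : Fin (2 ^ n)}, j ≤ k → p k * Real.exp ε / z ≤ p j * Real.exp ε / z :=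
    fun h => hmono (by gcongr; exact hanti h)
  have hb : ∀ {j k : Fin (2 ^ n)}, j ≤ k → p k * Real.exp (-ε) / z ≤ p j * Real.exp (-ε) / z :=
    fun h => hmono (by gcongr; exact hanti h)
  have hba : ∀ j, p j * Real.exp (-ε) / z ≤ p j * Real.exp ε / z :=
    fun j => hmono (mul_le_mul_of_nonneg_left hexp (hpos j).le)
  have hcross : p ⟨i + 1, hi⟩ * Real.exp ε / z ≤ p ⟨i, by omega⟩ * Real.exp (-ε) / z := by
    refine hmono ?_
    have h := (le_div_iff₀ hpi').1 hratio
    calc p ⟨i + 1, hi⟩ * Real.exp ε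
        = Real.exp (2 * ε) * p ⟨i + 1, hi⟩ * Real.exp (-ε) := by
          rw [show ε = 2 * ε + -ε by ring, Real.exp_add]; ring_nf
      _ ≤ _ := by gcongr
  have hsum : ∀ j, p j * Real.exp ε / z + p j * Real.exp (-ε) / z = p j := by
    intro j
    rw [← add_div, ← mul_add, ← hz, mul_div_assoc, div_self hz0.ne', mul_one]
  have hupper : PPA n ε p ⟨i, by omega⟩ ≤ p ⟨i, by omega⟩ := by
    rw [← hsum ⟨i, by omega⟩, PPA]
    refine add_le_add
      (ppaSorted_getD_le (m₁ := i) (m₂ := i) (by positivity) (by dsimp only; omega)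
        (fun j hj => ?_) (fun j hj => ?_))
      (ppaSorted_getD_le (m₁ := i + 1) (m₂ := i) (by positivity) (by dsimp only; omega)
        (fun j hj => ?_) (fun j hj => ?_))
    all_goals by_contra! hij; refine absurd ?_ (not_le.2 hj)
    · exact ha hij
    · exact (hba j).trans (ha hij)
    · exact (ha hij).trans hcross
    · exact hb hij
  have hlower : p ⟨i + 1, hi⟩ ≤ PPA n ε p ⟨i + 1, hi⟩ := by
    rw [← hsum ⟨i + 1, hi⟩, PPA]
    refine add_le_add
      (le_ppaSorted_getD (m₁ := i + 2) (m₂ := i + 1) (by dsimp only; omega) (by omega) (by omega)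
        (fun j hj => ?_) (fun j hj => ?_))
      (le_ppaSorted_getD (m₁ := i + 2) (m₂ := i + 2) (by dsimp only; omega) (by omega) (by omega)
        (fun j hj => ?_) (fun j hj => ?_))
    · exact ha (Nat.le_of_lt_succ hj)
    · exact hcross.trans (hb (Nat.le_of_lt_succ hj))
    · exact (hba _).trans (ha (Nat.le_of_lt_succ hj))
    · exact hb (Nat.le_of_lt_succ hj)
  exact ⟨hupper, hlower, div_le_div₀ hpi.le hupper hpi' hlower⟩
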